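/- Let G be a finite group, θ : G → G an involutive automorphism, and H ⊆ G a θ-stable subgroup (θ(H) = H). If for every g ∈ G there exist h₁, h₂ ∈ H such that h₁ g⁻¹ h₂ = θ(g), then for every irreducible complex representation π of G with π^H ≠ 0 one has dim(π^H) = 1 and π ∘ θ ≅ π*, and moreover π possesses a nonzero symmetric bilinear form B satisfying B(π(g)v, w) = B(v, π(θ(g⁻¹))w) for all g ∈ G and all vectors v, w (i.e., ε_θ(π) = 1). -/

import Mathlib

open scoped Classical TensorProduct

noncomputable section

namespace GK

variable {G : Type} [Group G]

/-- A complex representation is irreducible if it is nonzero and has no invariant subspaces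
other than `⊥` and `⊤`. -/
def IsIrred {V : Type} [AddCommGroup V] [Module ℂ V] (π : Representation ℂ G V) : Prop :=
  (⊥ : Submodule ℂ V) ≠ ⊤ ∧
    ∀ W : Submodule ℂ V, (∀ (g : G), ∀ v ∈ W, π g v ∈ W) → W = ⊥ ∨ W = ⊤

/-- The subspace `π^H` of vectors invariant under a subgroup `H`. -/
def invariantsOf {V : Type} [AddCommGroup V] [Module ℂ V] (π : Representation ℂ G V)
    (H : Subgroup G) : Submodule ℂ V where
  carrier := {v | ∀ h ∈ H, π h v = v}
  add_mem' := by
    intro a b ha hb h hh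
    simp [map_add, ha h hh, hb h hh]
  zero_mem' := by
    intro h hh
    simp
  smul_mem' := by
    intro c v hv h hh
    simp [map_smul, hv h hh]

/-- `(G, H)` is a Gelfand pair: every irreducible complex representation of `G` has at most
one-dimensional space of `H`-invariant vectors. -/
def IsGelfandPair (G : Type) [Group G] (H : Subgroup G) : Prop :=
  ∀ (V : Type) [AddCommGroup V] [Module ℂ V] [FiniteDimensional ℂ V]
    (π : Representation ℂ G V), IsIrred π →
      Module.finrank ℂ (invariantsOf π H) ≤ 1

/-- Isomorphism of representations. -/
def RepIso {V W : Type} [AddCommGroup V] [Module ℂ V] [AddCommGroup W] [Module ℂ W]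
    (π : Representation ℂ G V) (τ : Representation ℂ G W) : Prop :=
  ∃ e : V ≃ₗ[ℂ] W, ∀ (g : G) (v : V), e (π g v) = τ g (e v)

/-- `π ∘ θ ≅ π*`: the θ-twist of `π` is isomorphic to the dual (contragredient)
representation of `π`. -/
def ConjThetaIsoDual {V : Type} [AddCommGroup V] [Module ℂ V] (θ : G ≃* G)
    (π : Representation ℂ G V) : Prop :=
  RepIso (MonoidHom.comp π θ.toMonoidHom) π.dual

/-- `π` possesses a nonzero symmetric bilinear form `B` with
`B(π(g)v, w) = B(v, π(θ(g⁻¹))w)`. -/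
def HasSymForm {V : Type} [AddCommGroup V] [Module ℂ V] (θ : G ≃* G)
    (π : Representation ℂ G V) : Prop :=
  ∃ B : V →ₗ[ℂ] V →ₗ[ℂ] ℂ, B ≠ 0 ∧ (∀ v w, B v w = B w v) ∧
    ∀ (g : G) (v w : V), B (π g v) w = B v (π (θ g⁻¹) w)

/-- `π` possesses a nonzero antisymmetric bilinear form `B` with
`B(π(g)v, w) = B(v, π(θ(g⁻¹))w)`. -/
def HasAltForm {V : Type} [AddCommGroup V] [Module ℂ V] (θ : G ≃* G)
    (π : Representation ℂ G V) : Prop :=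
  ∃ B : V →ₗ[ℂ] V →ₗ[ℂ] ℂ, B ≠ 0 ∧ (∀ v w, B v w = - B w v) ∧
    ∀ (g : G) (v w : V), B (π g v) w = B v (π (θ g⁻¹) w)

/-- The twisted Frobenius–Schur indicator `ε_θ(π)`: `1` if `π` has a nonzero symmetric
θ-twisted invariant bilinear form, `-1` if it has a nonzero antisymmetric one, and `0`
otherwise (for irreducible `π` this last case is exactly `π ∘ θ ≇ π*`). -/
def eps {V : Type} [AddCommGroup V] [Module ℂ V] (θ : G ≃* G)
    (π : Representation ℂ G V) : ℤ :=
  if HasSymForm θ π then 1 else if HasAltForm θ π then -1 else 0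

end GK

namespace GK

section Average

variable {G : Type} [Group G] {V : Type} [AddCommGroup V] [Module ℂ V] [Fintype G]

/-- The averaging operator onto the `H`-invariant vectors. -/
def average (π : Representation ℂ G V) (H : Subgroup G) : Module.End ℂ V :=
  (Fintype.card H : ℂ)⁻¹ • ∑ h : H, π h

variable (π : Representation ℂ G V) (H : Subgroup G)

lemma map_mul_average {h : G} (hh : h ∈ H) : π h * average π H = average π H := by
  rw [average, mul_smul_comm, Finset.mul_sum]
  congr 1
  exact Fintype.sum_equiv (Equiv.mulLeft (⟨h, hh⟩ : H)) _ _ fun x ↦ by simp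

lemma average_mul_map {h : G} (hh : h ∈ H) : average π H * π h = average π H := by
  rw [average, smul_mul_assoc, Finset.sum_mul]
  congr 1
  exact Fintype.sum_equiv (Equiv.mulRight (⟨h, hh⟩ : H)) _ _ fun x ↦ by simp

lemma average_mem (v : V) : average π H v ∈ invariantsOf π H := fun _ hh ↦
  LinearMap.congr_fun (map_mul_average π H hh) v

lemma average_apply_of_mem {v : V} (hv : v ∈ invariantsOf π H) : average π H v = v := by
  have hs : ∑ h : H, π h v = (Fintype.card H : ℂ) • v := by
    rw [Finset.sum_congr rfl fun (h : H) _ ↦ hv h h.2]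
    simp [Nat.cast_smul_eq_nsmul]
  rw [average, LinearMap.smul_apply, LinearMap.sum_apply, hs, smul_smul,
    inv_mul_cancel₀ (Nat.cast_ne_zero.mpr Fintype.card_ne_zero), one_smul]

/-- The action of the Hecke operator attached to the double coset `H g H`. -/
def hecke (g : G) : Module.End ℂ V :=
  average π H * π g * average π H

lemma hecke_mul_mul (g : G) {a b : G} (ha : a ∈ H) (hb : b ∈ H) :
    hecke π H (a * g * b) = hecke π H g := by
  simp only [hecke, map_mul]
  calc _ = (average π H * π a) * π g * (π b * average π H) := by simp only [mul_assoc]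
    _ = _ := by rw [average_mul_map π H ha, map_mul_average π H hb]

lemma hecke_mul_hecke (a b : G) :
    hecke π H a * hecke π H b =
      (Fintype.card H : ℂ)⁻¹ • ∑ h : H, hecke π H (a * h * b) := by
  have hP : average π H * average π H = average π H :=
    LinearMap.ext fun v ↦ average_apply_of_mem π H (average_mem π H v)
  calc hecke π H a * hecke π H b
      = average π H * π a * (average π H * average π H) * π b * average π H := by
        simp only [hecke, mul_assoc]
    _ = average π H * π a * average π H * π b * average π H := by rw [hP]
    _ = average π H * π a * ((Fintype.card H : ℂ)⁻¹ • ∑ h : H, π h) * π b * average π H := rfl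
    _ = _ := by
      simp only [mul_smul_comm, smul_mul_assoc, Finset.mul_sum, Finset.sum_mul, hecke, map_mul,
        mul_assoc]

variable {π H} {θ : G ≃* G}

lemma hecke_theta (hGK : ∀ g : G, ∃ h₁ ∈ H, ∃ h₂ ∈ H, h₁ * g⁻¹ * h₂ = θ g) (g : G) :
    hecke π H (θ g) = hecke π H g⁻¹ := by
  obtain ⟨a, ha, b, hb, h⟩ := hGK g
  rw [← h, hecke_mul_mul π H _ ha hb]

lemma hecke_commute (hH : H.map θ.toMonoidHom = H)
    (hGK : ∀ g : G, ∃ h₁ ∈ H, ∃ h₂ ∈ H, h₁ * g⁻¹ * h₂ = θ g) (a b : G) :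
    hecke π H a * hecke π H b = hecke π H b * hecke π H a := by
  have hσ (g : G) : hecke π H (θ g⁻¹) = hecke π H g := by
    rw [hecke_theta hGK, inv_inv]
  have hmem (h : H) : θ h ∈ H := hH.le ⟨h, h.2, rfl⟩
  have hbij : Function.Bijective fun h : H ↦ (⟨θ h⁻¹, hmem h⁻¹⟩ : H) := by
    apply Function.Injective.bijective_of_finite
    intro x y hxy
    simpa using hxy
  calc hecke π H a * hecke π H b
      = hecke π H (θ a⁻¹) * hecke π H (θ b⁻¹) := by rw [hσ, hσ]
    _ = (Fintype.card H : ℂ)⁻¹ • ∑ h : H, hecke π H (θ a⁻¹ * θ h⁻¹ * θ b⁻¹) := by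
      rw [hecke_mul_hecke, ← hbij.sum_comp]
    _ = (Fintype.card H : ℂ)⁻¹ • ∑ h : H, hecke π H (b * h * a) := by
      congr 1
      refine Finset.sum_congr rfl fun h _ ↦ ?_
      rw [← hσ (b * h * a), mul_inv_rev, mul_inv_rev, map_mul, map_mul, mul_assoc]
    _ = hecke π H b * hecke π H a := (hecke_mul_hecke π H b a).symm

end Average

section Irreducible

variable {G : Type} [Group G] {V : Type} [AddCommGroup V] [Module ℂ V] {π : Representation ℂ G V}

lemma IsIrred.span_orbit_eq_top (hπ : IsIrred π) {v : V} (hv : v ≠ 0) :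
    Submodule.span ℂ (Set.range fun g ↦ π g v) = ⊤ := by
  refine (hπ.2 _ fun g w hw ↦ ?_).resolve_left fun h ↦ hv ?_
  · have := Submodule.mem_map_of_mem (f := π g) hw
    rw [Submodule.map_span] at this
    refine Submodule.span_mono ?_ this
    rintro _ ⟨_, ⟨x, rfl⟩, rfl⟩
    exact ⟨g * x, by simp⟩
  · rw [← Submodule.mem_bot ℂ, ← h]
    exact Submodule.subset_span ⟨1, by simp⟩

lemma IsIrred.exists_eq_algebraMap [FiniteDimensional ℂ V] (hπ : IsIrred π) (S : Module.End ℂ V)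
    (hS : ∀ g, Commute S (π g)) : ∃ c : ℂ, S = algebraMap ℂ _ c := by
  have : Nontrivial V := by
    by_contra h
    rw [not_nontrivial_iff_subsingleton] at h
    exact hπ.1 (Subsingleton.elim _ _)
  obtain ⟨c, hc⟩ := Module.End.exists_eigenvalue S
  refine ⟨c, LinearMap.ext fun v ↦ ?_⟩
  have htop := (hπ.2 (S.eigenspace c) fun g v hv ↦ ?_).resolve_left hc
  · have hv : v ∈ S.eigenspace c := htop ▸ Submodule.mem_top
    simpa using Module.End.mem_eigenspace_iff.mp hv
  · rw [Module.End.mem_eigenspace_iff] at hv ⊢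
    have := LinearMap.congr_fun (hS g).eq v
    simp only [Module.End.mul_apply] at this
    rw [this, hv, map_smul]

lemma IsIrred.sum_matrixCoeff_ne_zero [FiniteDimensional ℂ V] [Fintype G] (hπ : IsIrred π)
    {v : V} {l : V →ₗ[ℂ] ℂ} (hl : l v = 1) :
    ∑ g, l (π g v) * l (π g⁻¹ v) ≠ 0 := by
  set S : Module.End ℂ V := ∑ g : G, π g⁻¹ * l.smulRight v * π g with hSdef
  obtain ⟨c, hc⟩ := hπ.exists_eq_algebraMap S fun x ↦ by
    rw [Commute, SemiconjBy, hSdef, Finset.sum_mul, Finset.mul_sum]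
    refine Fintype.sum_equiv (Equiv.mulRight x) _ _ fun g ↦ ?_
    rw [Equiv.coe_mulRight, mul_inv_rev, map_mul, map_mul]
    simp only [← mul_assoc]
    rw [← map_mul, mul_inv_cancel, map_one, one_mul]
  have htr : LinearMap.trace ℂ V S = Fintype.card G := by
    have (g : G) : LinearMap.trace ℂ V (π g⁻¹ * l.smulRight v * π g) = 1 := by
      rw [LinearMap.trace_mul_comm, ← mul_assoc, ← map_mul, mul_inv_cancel, map_one, one_mul,
        LinearMap.trace_smulRight, hl]
    rw [hSdef, map_sum, Finset.sum_congr rfl fun g _ ↦ this g]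
    simp
  have hlS : ∑ g, l (π g v) * l (π g⁻¹ v) = c := by
    have := congrArg (fun T : Module.End ℂ V ↦ l (T v)) hc
    simpa [hSdef, LinearMap.sum_apply, hl] using this
  rw [hlS]
  rintro rfl
  rw [map_zero] at hc
  rw [hc, map_zero] at htr
  exact Nat.cast_ne_zero.mpr Fintype.card_ne_zero htr.symm

lemma IsIrred.finrank_invariantsOf_eq_one [FiniteDimensional ℂ V] [Fintype G] (hπ : IsIrred π)
    {H : Subgroup G} (hcomm : ∀ a b, hecke π H a * hecke π H b = hecke π H b * hecke π H a)
    (hne : invariantsOf π H ≠ ⊥) : Module.finrank ℂ (invariantsOf π H) = 1 := by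
  have hspan {v w : V} (hv : v ∈ invariantsOf π H) (hv0 : v ≠ 0) (hw : w ∈ invariantsOf π H) :
      w ∈ Submodule.span ℂ (Set.range fun g ↦ hecke π H g v) := by
    have hw' : w ∈ Submodule.span ℂ (Set.range fun g ↦ π g v) :=
      hπ.span_orbit_eq_top hv0 ▸ Submodule.mem_top
    have := Submodule.mem_map_of_mem (f := average π H) hw'
    rw [average_apply_of_mem π H hw, Submodule.map_span, ← Set.range_comp] at this
    simpa [hecke, Function.comp_def, average_apply_of_mem π H hv] using this
  have hscalar (g : G) : ∃ c : ℂ, ∀ w ∈ invariantsOf π H, hecke π H g w = c • w := by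
    have : Nontrivial (invariantsOf π H) := Submodule.nontrivial_iff_ne_bot.mpr hne
    obtain ⟨c, hc⟩ := Module.End.exists_eigenvalue
      ((hecke π H g).restrict (p := invariantsOf π H) (q := invariantsOf π H)
        fun v _ ↦ average_mem π H _)
    obtain ⟨v, hv⟩ := hc.exists_hasEigenvector
    have hv0 : (v : V) ≠ 0 := by simpa using hv.2
    have hvc : hecke π H g v = c • (v : V) := congrArg Subtype.val hv.apply_eq_smul
    refine ⟨c, fun w hw ↦ Module.End.mem_eigenspace_iff.mp ?_⟩
    refine Submodule.span_le.mpr ?_ (hspan v.2 hv0 hw)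
    rintro _ ⟨a, rfl⟩
    refine Module.End.mem_eigenspace_iff.mpr ?_
    have := LinearMap.congr_fun (hcomm g a) (v : V)
    simp only [Module.End.mul_apply] at this
    rw [this, hvc, map_smul]
  obtain ⟨v, hv, hv0⟩ := Submodule.exists_mem_ne_zero_of_ne_bot hne
  refine finrank_eq_one (⟨v, hv⟩ : invariantsOf π H) (by simpa using hv0) fun w ↦ ?_
  have hle : Submodule.span ℂ (Set.range fun g ↦ hecke π H g v) ≤ Submodule.span ℂ {v} := by
    rw [Submodule.span_le]
    rintro _ ⟨g, rfl⟩
    obtain ⟨c, hc⟩ := hscalar g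
    exact Submodule.mem_span_singleton.mpr ⟨c, (hc v hv).symm⟩
  obtain ⟨c, hc⟩ := Submodule.mem_span_singleton.mp (hle (hspan hv hv0 w.2))
  exact ⟨c, Subtype.ext hc⟩

lemma IsIrred.conjThetaIsoDual [FiniteDimensional ℂ V] (hπ : IsIrred π) {θ : G ≃* G}
    (hθ : ∀ g, θ (θ g) = g) (hB : HasSymForm θ π) : ConjThetaIsoDual θ π := by
  obtain ⟨B, hB0, -, hB⟩ := hB
  have hker : LinearMap.ker B = ⊥ := by
    refine (hπ.2 _ fun g v hv ↦ ?_).resolve_right fun h ↦ hB0 (LinearMap.ker_eq_top.mp h)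
    rw [LinearMap.mem_ker] at hv ⊢
    ext w
    rw [hB, hv]
    rfl
  refine ⟨LinearEquiv.ofInjectiveOfFinrankEq B (LinearMap.ker_eq_bot.mp hker)
    (Subspace.dual_finrank_eq).symm, fun g v ↦ LinearMap.ext fun w ↦ ?_⟩
  change B (π (θ g) v) w = B v (π g⁻¹ w)
  rw [hB, ← map_inv, hθ]

/-- The bilinear form `(v, w) ↦ ∑ g, l (π g v) * l (π (θ g) w)`. -/
def thetaForm [Fintype G] (π : Representation ℂ G V) (θ : G ≃* G) (l : V →ₗ[ℂ] ℂ) :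
    V →ₗ[ℂ] V →ₗ[ℂ] ℂ :=
  ∑ g : G, (LinearMap.mul ℂ ℂ).compl₁₂ (l ∘ₗ π g) (l ∘ₗ π (θ g))

lemma thetaForm_apply [Fintype G] (θ : G ≃* G) (l : V →ₗ[ℂ] ℂ) (v w : V) :
    thetaForm π θ l v w = ∑ g, l (π g v) * l (π (θ g) w) := by
  simp [thetaForm, LinearMap.sum_apply]

lemma IsIrred.hasSymForm [FiniteDimensional ℂ V] [Fintype G] (hπ : IsIrred π) {θ : G ≃* G}
    (hθ : ∀ g, θ (θ g) = g) {H : Subgroup G}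
    (hhecke : ∀ g, hecke π H (θ g) = hecke π H g⁻¹) (hne : invariantsOf π H ≠ ⊥) :
    HasSymForm θ π := by
  obtain ⟨v, hv, hv0⟩ := Submodule.exists_mem_ne_zero_of_ne_bot hne
  obtain ⟨l₀, hl₀⟩ := Module.Projective.exists_dual_ne_zero ℂ hv0
  set l : V →ₗ[ℂ] ℂ := (l₀ v)⁻¹ • l₀ ∘ₗ average π H with hl
  have hlv : l v = 1 := by
    simp [hl, average_apply_of_mem π H hv, hl₀]
  have hlθ (g : G) : l (π (θ g) v) = l (π g⁻¹ v) := by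
    have := LinearMap.congr_fun (hhecke g) v
    simp only [hecke, Module.End.mul_apply, average_apply_of_mem π H hv] at this
    simp [hl, this]
  refine ⟨thetaForm π θ l, fun h ↦ hπ.sum_matrixCoeff_ne_zero hlv ?_, fun x y ↦ ?_,
    fun a x y ↦ ?_⟩
  · have := LinearMap.congr_fun₂ h v v
    simpa [thetaForm_apply, hlθ] using this
  · rw [thetaForm_apply, thetaForm_apply]
    refine Fintype.sum_equiv θ.toEquiv _ _ fun g ↦ ?_
    simp [hθ, mul_comm]
  · rw [thetaForm_apply, thetaForm_apply]
    refine Fintype.sum_equiv (Equiv.mulRight a) _ _ fun g ↦ ?_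
    simp [← Module.End.mul_apply, ← map_mul, -map_inv]

end Irreducible

end GK

/-- If `h₁ g⁻¹ h₂ = θ(g)` always has a solution in the θ-stable subgroup `H`,
then every `H`-distinguished irreducible representation `π` has `dim π^H = 1`, satisfies
`π ∘ θ ≅ π*`, and carries a nonzero symmetric θ-twisted invariant bilinear form
(i.e. `ε_θ(π) = 1`). -/
theorem distinguished_of_GK_condition {G : Type} [Group G] [Fintype G]
    (θ : G ≃* G) (hθ : ∀ g : G, θ (θ g) = g)
    (H : Subgroup G) (hH : H.map θ.toMonoidHom = H)
    (hGK : ∀ g : G, ∃ h₁ ∈ H, ∃ h₂ ∈ H, h₁ * g⁻¹ * h₂ = θ g) :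
    ∀ (V : Type) [AddCommGroup V] [Module ℂ V] [FiniteDimensional ℂ V]
      (π : Representation ℂ G V), GK.IsIrred π → GK.invariantsOf π H ≠ ⊥ →
        Module.finrank ℂ (GK.invariantsOf π H) = 1 ∧
        GK.ConjThetaIsoDual θ π ∧
        GK.HasSymForm θ π := by
  intro V _ _ _ π hπ hne
  have hB := hπ.hasSymForm hθ (GK.hecke_theta hGK) hne
  exact ⟨hπ.finrank_invariantsOf_eq_one (GK.hecke_commute hH hGK) hne,
    hπ.conjThetaIsoDual hθ hB, hB⟩
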